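/- Suppose n ≥ 4. In H(e,e,n), if a_{n−1} = s_{n−1} ⋯ s₃ t_k with 0 ≤ k ≤ e−1 and aₙ = sₙ ⋯ s₃ t_l with 0 ≤ l ≤ e−1, then sₙ·(a_{n−1} aₙ) belongs to Span(Λ_{n−1} Λₙ). -/

import Mathlib

noncomputable section

open scoped Pointwise

/-- The base ring `R₀ = ℤ[a]`. -/
abbrev R0 : Type := Polynomial ℤ

/-- The variable `a ∈ R₀`. -/
def aP : R0 := Polynomial.X

/-- Generators of the Corran–Picantin presentation: `t_i` for `i ∈ ℤ/eℤ` and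
`s_j` for `3 ≤ j ≤ n`. -/
inductive HGen (e n : ℕ) : Type
  | t : ZMod e → HGen e n
  | s : (j : ℕ) → 3 ≤ j → j ≤ n → HGen e n

open FreeAlgebra

/-- The free `R₀`-algebra on the generators. -/
abbrev FA (e n : ℕ) : Type := FreeAlgebra R0 (HGen e n)

/-- The defining relations of the Hecke algebra `H(e,e,n)`. -/
inductive HRel (e n : ℕ) : FA e n → FA e n → Prop
  | tt (i j : ZMod e) :
      HRel e n (ι R0 (HGen.t i) * ι R0 (HGen.t (i - 1)))
               (ι R0 (HGen.t j) * ι R0 (HGen.t (j - 1)))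
  | tst (i : ZMod e) (h : 3 ≤ n) :
      HRel e n (ι R0 (HGen.t i) * ι R0 (HGen.s 3 le_rfl h) * ι R0 (HGen.t i))
               (ι R0 (HGen.s 3 le_rfl h) * ι R0 (HGen.t i) * ι R0 (HGen.s 3 le_rfl h))
  | st (i : ZMod e) (j : ℕ) (h3 : 3 ≤ j) (h4 : 4 ≤ j) (hn : j ≤ n) :
      HRel e n (ι R0 (HGen.s j h3 hn) * ι R0 (HGen.t i))
               (ι R0 (HGen.t i) * ι R0 (HGen.s j h3 hn))
  | braid (i : ℕ) (h3 : 3 ≤ i) (h3' : 3 ≤ i + 1) (hn' : i ≤ n) (hn : i + 1 ≤ n) :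
      HRel e n (ι R0 (HGen.s i h3 hn') * ι R0 (HGen.s (i + 1) h3' hn) * ι R0 (HGen.s i h3 hn'))
               (ι R0 (HGen.s (i + 1) h3' hn) * ι R0 (HGen.s i h3 hn') * ι R0 (HGen.s (i + 1) h3' hn))
  | comm (i j : ℕ) (h3i : 3 ≤ i) (hni : i ≤ n) (h3j : 3 ≤ j) (hnj : j ≤ n)
      (hij : i + 1 < j ∨ j + 1 < i) :
      HRel e n (ι R0 (HGen.s i h3i hni) * ι R0 (HGen.s j h3j hnj))
               (ι R0 (HGen.s j h3j hnj) * ι R0 (HGen.s i h3i hni))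
  | tq (i : ZMod e) :
      HRel e n (ι R0 (HGen.t i) * ι R0 (HGen.t i))
               (algebraMap R0 (FA e n) aP * ι R0 (HGen.t i) + 1)
  | sq (j : ℕ) (h3 : 3 ≤ j) (hn : j ≤ n) :
      HRel e n (ι R0 (HGen.s j h3 hn) * ι R0 (HGen.s j h3 hn))
               (algebraMap R0 (FA e n) aP * ι R0 (HGen.s j h3 hn) + 1)

/-- The Hecke algebra `H(e,e,n)`. -/
abbrev Hecke (e n : ℕ) : Type := RingQuot (HRel e n)

/-- The generator `t_i` of `H(e,e,n)`. -/
def tH (e n : ℕ) (i : ZMod e) : Hecke e n :=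
  RingQuot.mkAlgHom R0 (HRel e n) (ι R0 (HGen.t i))

/-- The generator `s_j` of `H(e,e,n)` (junk value `1` when `j` is out of range). -/
def sH (e n : ℕ) (j : ℕ) : Hecke e n :=
  if h : 3 ≤ j ∧ j ≤ n then RingQuot.mkAlgHom R0 (HRel e n) (ι R0 (HGen.s j h.1 h.2)) else 1

/-- Decreasing-index product `s_m s_{m-1} ⋯ s_{i'}` (empty when `m < i'`). -/
def sDescH (e n m i' : ℕ) : Hecke e n :=
  (((List.range' i' (m + 1 - i')).reverse).map (sH e n)).prod

/-- Increasing-index product `s_{i'} s_{i'+1} ⋯ s_m` (empty when `m < i'`). -/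
def sAscH (e n i' m : ℕ) : Hecke e n :=
  ((List.range' i' (m + 1 - i')).map (sH e n)).prod

/-- `Λ₂ = {1} ∪ {t_k : 0 ≤ k ≤ e-1} ∪ {t_k t₀ : 1 ≤ k ≤ e-1}` in `H(e,e,n)`. -/
def Lam2 (e n : ℕ) : Set (Hecke e n) :=
  {1} ∪ {x | ∃ k < e, x = tH e n (k : ZMod e)} ∪
    {x | ∃ k, 1 ≤ k ∧ k < e ∧ x = tH e n (k : ZMod e) * tH e n 0}

/-- `Λ_m = {1} ∪ {s_m ⋯ s_{i'} : 3 ≤ i' ≤ m} ∪ {s_m ⋯ s₃ t_k : 0 ≤ k ≤ e-1}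
∪ {s_m ⋯ s₃ t_k s₂ s₃ ⋯ s_{i'} : 1 ≤ k ≤ e-1, 2 ≤ i' ≤ m}` in `H(e,e,n)`,
where `s₂ = t₀`. -/
def LamH (e n m : ℕ) : Set (Hecke e n) :=
  {1} ∪ {x | ∃ i', 3 ≤ i' ∧ i' ≤ m ∧ x = sDescH e n m i'} ∪
    {x | ∃ k < e, x = sDescH e n m 3 * tH e n (k : ZMod e)} ∪
    {x | ∃ k, 1 ≤ k ∧ k < e ∧ ∃ i', 2 ≤ i' ∧ i' ≤ m ∧
      x = sDescH e n m 3 * tH e n (k : ZMod e) * tH e n 0 * sAscH e n 3 i'}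


theorem hk_tt (e n : ℕ) (i j : ZMod e) :
    tH e n i * tH e n (i - 1) = tH e n j * tH e n (j - 1) := by
  simp only [tH, ← map_mul]
  exact RingQuot.mkAlgHom_rel R0 (HRel.tt i j)

theorem hk_tst (e n : ℕ) (h : 3 ≤ n) (i : ZMod e) :
    tH e n i * sH e n 3 * tH e n i = sH e n 3 * tH e n i * sH e n 3 := by
  rw [sH, dif_pos ⟨le_rfl, h⟩]
  simp only [tH, ← map_mul]
  exact RingQuot.mkAlgHom_rel R0 (HRel.tst i h)

theorem hk_st (e n : ℕ) (i : ZMod e) (j : ℕ) (h4 : 4 ≤ j) (hn : j ≤ n) :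
    sH e n j * tH e n i = tH e n i * sH e n j := by
  rw [sH, dif_pos ⟨by omega, hn⟩]
  simp only [tH, ← map_mul]
  exact RingQuot.mkAlgHom_rel R0 (HRel.st i j (by omega) h4 hn)

theorem hk_braid (e n : ℕ) (i : ℕ) (h3 : 3 ≤ i) (hn : i + 1 ≤ n) :
    sH e n i * sH e n (i + 1) * sH e n i = sH e n (i + 1) * sH e n i * sH e n (i + 1) := by
  rw [sH, dif_pos ⟨h3, by omega⟩, sH, dif_pos ⟨by omega, hn⟩]
  simp only [← map_mul]
  exact RingQuot.mkAlgHom_rel R0 (HRel.braid i h3 (by omega) (by omega) hn)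

theorem hk_comm (e n : ℕ) (i j : ℕ) (h3i : 3 ≤ i) (hni : i ≤ n) (h3j : 3 ≤ j) (hnj : j ≤ n)
    (hij : i + 1 < j ∨ j + 1 < i) :
    sH e n i * sH e n j = sH e n j * sH e n i := by
  rw [sH, dif_pos ⟨h3i, hni⟩, sH, dif_pos ⟨h3j, hnj⟩]
  simp only [← map_mul]
  exact RingQuot.mkAlgHom_rel R0 (HRel.comm i j h3i hni h3j hnj hij)

theorem hk_tq (e n : ℕ) (i : ZMod e) :
    tH e n i * tH e n i = aP • tH e n i + 1 := by
  have h := RingQuot.mkAlgHom_rel R0 (HRel.tq (n := n) i)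
  simp only [map_mul, map_add, map_one, AlgHom.commutes] at h
  rw [Algebra.smul_def]
  exact h

theorem sDesc_succ (e n m i : ℕ) (h : i ≤ m + 1) :
    sDescH e n (m + 1) i = sH e n (m + 1) * sDescH e n m i := by
  unfold sDescH
  rw [show m + 1 + 1 - i = (m + 1 - i) + 1 by omega, List.range'_concat]
  simp only [List.reverse_append, List.map_append, List.prod_append, List.reverse_singleton,
    List.map_cons, List.map_nil, List.prod_singleton]
  rw [show i + 1 * (m + 1 - i) = m + 1 by omega]

theorem sDesc_empty (e n m i : ℕ) (h : m < i) : sDescH e n m i = 1 := by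
  unfold sDescH
  rw [show m + 1 - i = 0 by omega]
  simp

theorem sDesc_last (e n m : ℕ) (h : 3 ≤ m) :
    sDescH e n m 3 = sDescH e n m 4 * sH e n 3 := by
  unfold sDescH
  rw [show m + 1 - 3 = (m + 1 - 4) + 1 by omega, List.range'_succ]
  simp

/-- `s_j ⋯ s_4` commutes with each `t_i`. -/
theorem sDesc_t (e n : ℕ) (i : ZMod e) (j : ℕ) (hj : j ≤ n) :
    tH e n i * sDescH e n j 4 = sDescH e n j 4 * tH e n i := by
  induction j with
  | zero => rw [sDesc_empty _ _ _ _ (by omega)]; simp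
  | succ j ih =>
    by_cases h : 4 ≤ j + 1
    · rw [sDesc_succ _ _ _ _ h, ← mul_assoc, ← hk_st e n i (j + 1) h hj, mul_assoc,
        ih (by omega), mul_assoc]
    · rw [sDesc_empty _ _ _ _ (by omega)]; simp

theorem sDesc_comm (e n : ℕ) (i m : ℕ) (hi : i ≤ n) (hm : m + 1 < i) :
    sDescH e n m 3 * sH e n i = sH e n i * sDescH e n m 3 := by
  induction m with
  | zero => rw [sDesc_empty _ _ _ _ (by omega)]; simp
  | succ m ih =>
    by_cases h : 3 ≤ m + 1
    · rw [sDesc_succ _ _ _ _ h, mul_assoc, ih (by omega), ← mul_assoc,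
        hk_comm e n (m + 1) i h (by omega) (by omega) hi (by omega), mul_assoc]
    · rw [sDesc_empty _ _ _ _ (by omega)]; simp

/-- `D_m s_{i+1} = s_i D_m`. -/
theorem sDesc_shift (e n : ℕ) (i : ℕ) (hi : 3 ≤ i) (m : ℕ) (him : i + 1 ≤ m) (hm : m ≤ n) :
    sDescH e n m 3 * sH e n (i + 1) = sH e n i * sDescH e n m 3 := by
  induction m, him using Nat.le_induction with
  | base =>
    obtain ⟨r, rfl⟩ : ∃ r, i = r + 1 := ⟨i - 1, by omega⟩
    rw [sDesc_succ _ _ _ _ (by omega), sDesc_succ _ _ _ _ (by omega), mul_assoc, mul_assoc,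
      sDesc_comm e n (r + 1 + 1) r hm (by omega)]
    simp only [← mul_assoc]
    rw [← hk_braid e n (r + 1) hi hm]
  | succ m him ih =>
    rw [sDesc_succ _ _ _ _ (by omega), mul_assoc, ih (by omega), ← mul_assoc,
      hk_comm e n (m + 1) i (by omega) hm hi (by omega) (by omega), mul_assoc]

theorem sDesc_shift_all (e n : ℕ) (j : ℕ) (hj : j + 1 ≤ n) (h2 : 2 ≤ j) :
    sDescH e n n 3 * sDescH e n (j + 1) 4 = sDescH e n j 3 * sDescH e n n 3 := by
  induction j, h2 using Nat.le_induction with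
  | base => rw [sDesc_empty e n (2 + 1) 4 (by omega), sDesc_empty e n 2 3 (by omega)]; simp
  | succ j h2 ih =>
    rw [sDesc_succ _ _ (j + 1) _ (by omega), ← mul_assoc,
      sDesc_shift e n (j + 1) (by omega) n hj le_rfl, mul_assoc, ih (by omega),
      sDesc_succ _ _ j _ (by omega), mul_assoc]

/-- `t_k t_l = a t_l + t_{k-1} t_{l-1} - a t_{k-1}`. -/
theorem tt_reduce (e n : ℕ) (k l : ZMod e) :
    tH e n k * tH e n l =
      aP • tH e n l + tH e n (k - 1) * tH e n (l - 1) + (-aP) • tH e n (k - 1) := by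
  have h := hk_tt e n l k
  have hk := hk_tq e n k
  have hl := hk_tq e n (l - 1)
  -- multiply `t_l t_{l-1} = t_k t_{k-1}` by `t_k` on the left and `t_{l-1}` on the right
  have h1 : tH e n k * (tH e n l * tH e n (l - 1)) =
      aP • (tH e n l * tH e n (l - 1)) + tH e n (k - 1) := by
    rw [h, ← mul_assoc, hk, add_mul, one_mul, smul_mul_assoc]
  have h2 := congrArg (· * tH e n (l - 1)) h1
  simp only [add_mul, smul_mul_assoc, mul_assoc, hl, mul_add, mul_one, mul_smul_comm] at h2
  have h3 := congrArg (aP • ·) h1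
  simp only [smul_add] at h3
  rw [h3, smul_add] at h2
  have h4 : tH e n k * tH e n l + aP • tH e n (k - 1) =
    aP • tH e n l + tH e n (k - 1) * tH e n (l - 1) := by
    have := sub_eq_zero.mpr h2
    rw [← sub_eq_zero, ← this]
    abel
  rw [← h4, add_assoc, ← add_smul, add_neg_cancel, zero_smul, add_zero]

theorem tt_mem (e n : ℕ) (l : ℕ) (k : ZMod e) :
    tH e n k * tH e n (l : ZMod e) ∈ Submodule.span R0
      (Set.range (tH e n) ∪ Set.range (fun i => tH e n i * tH e n 0)) := by
  induction l generalizing k with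
  | zero => exact Submodule.subset_span (Or.inr ⟨k, by simp⟩)
  | succ l ih =>
    rw [tt_reduce]
    have h := ih (k - 1)
    rw [show (((l + 1 : ℕ) : ZMod e) - 1) = l by push_cast; ring]
    have ht : ∀ i : ZMod e, tH e n i ∈ Submodule.span R0
        (Set.range (tH e n) ∪ Set.range (fun i => tH e n i * tH e n 0)) := fun i =>
      Submodule.subset_span (Or.inl ⟨i, rfl⟩)
    refine Submodule.add_mem _ (Submodule.add_mem _ ?_ h) ?_
    · exact Submodule.smul_mem _ _ (ht _)
    · exact Submodule.smul_mem _ _ (ht _)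

/-- `D_n t_k D_n t_l = D_{n-1} t_k D_n t_k t_l`. -/
theorem key_identity (e n : ℕ) (hn : 4 ≤ n) (k l : ZMod e) :
    sH e n n * ((sDescH e n (n - 1) 3 * tH e n k) * (sDescH e n n 3 * tH e n l)) =
      (sDescH e n (n - 1) 3 * tH e n k) * (sDescH e n n 3 * (tH e n k * tH e n l)) := by
  obtain ⟨m, rfl⟩ : ∃ m, n = m + 1 := ⟨n - 1, by omega⟩
  simp only [Nat.add_sub_cancel]
  have hD := sDesc_succ e (m + 1) m 3 (by omega)
  have hL := sDesc_last e (m + 1) (m + 1) (by omega)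
  have hT := sDesc_t e (m + 1) k (m + 1) le_rfl
  have hS := sDesc_shift_all e (m + 1) m le_rfl (by omega)
  have hB := hk_tst e (m + 1) (by omega) k
  generalize sDescH e (m + 1) (m + 1) 3 = D at *
  generalize sDescH e (m + 1) (m + 1) 4 = F at *
  generalize sDescH e (m + 1) m 3 = D' at *
  generalize sH e (m + 1) (m + 1) = s at *
  generalize sH e (m + 1) 3 = s3 at *
  generalize tH e (m + 1) k = t at *
  generalize tH e (m + 1) l = u at *
  calc s * ((D' * t) * (D * u)) = (s * D') * t * D * u := by simp only [mul_assoc]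
    _ = D * t * (F * s3) * u := by rw [← hD, ← hL]
    _ = D * (t * F) * s3 * u := by simp only [mul_assoc]
    _ = (D * F) * t * s3 * u := by rw [hT]; simp only [mul_assoc]
    _ = D' * (F * s3) * t * s3 * u := by rw [hS, hL]
    _ = D' * F * (s3 * t * s3) * u := by simp only [mul_assoc]
    _ = D' * (F * t) * s3 * t * u := by rw [← hB]; simp only [mul_assoc]
    _ = D' * t * (F * s3) * t * u := by rw [← hT]; simp only [mul_assoc]
    _ = (D' * t) * (D * (t * u)) := by rw [← hL]; simp only [mul_assoc]

/-- For `n ≥ 4`, `a_{n-1} = s_{n-1} ⋯ s₃ t_k` with `0 ≤ k ≤ e-1` and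
`aₙ = sₙ ⋯ s₃ t_l` with `0 ≤ l ≤ e-1`, the element `sₙ·(a_{n-1} aₙ)` lies in
`Span(Λ_{n-1} Λₙ)`. -/
theorem sn_mul_st_st_mem_span (e n : ℕ) (he : 1 ≤ e) (hn : 4 ≤ n)
    (k : ℕ) (hk : k < e) (l : ℕ) (hl : l < e) :
    sH e n n * ((sDescH e n (n - 1) 3 * tH e n (k : ZMod e)) *
        (sDescH e n n 3 * tH e n (l : ZMod e))) ∈
      Submodule.span R0 (LamH e n (n - 1) * LamH e n n) := by
  have : NeZero e := ⟨by omega⟩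
  have hcast : ∀ i : ZMod e, ((i.val : ℕ) : ZMod e) = i := fun i => ZMod.natCast_zmod_val i
  have hA : sDescH e n (n - 1) 3 * tH e n (k : ZMod e) ∈ LamH e n (n - 1) :=
    Or.inl (Or.inr ⟨k, hk, rfl⟩)
  have hB1 : sDescH e n n 3 ∈ LamH e n n :=
    Or.inl (Or.inl (Or.inr ⟨3, le_rfl, by omega, rfl⟩))
  have hB2 : ∀ i : ZMod e, sDescH e n n 3 * tH e n i ∈ LamH e n n := fun i =>
    Or.inl (Or.inr ⟨i.val, ZMod.val_lt i, by rw [hcast]⟩)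
  have hB3 : ∀ i : ZMod e, i ≠ 0 →
      sDescH e n n 3 * (tH e n i * tH e n 0) ∈ LamH e n n := fun i hi =>
    Or.inr ⟨i.val, Nat.one_le_iff_ne_zero.mpr (by simpa [ZMod.val_eq_zero] using hi),
      ZMod.val_lt i, 2, le_rfl, by omega, by simp [hcast, sAscH, mul_assoc]⟩
  rw [key_identity e n hn]
  have hm := tt_mem e n l (k : ZMod e)
  generalize tH e n (k : ZMod e) * tH e n (l : ZMod e) = y at hm ⊢
  induction hm using Submodule.span_induction with
  | mem x hx =>
    rcases hx with ⟨i, rfl⟩ | ⟨i, rfl⟩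
    · exact Submodule.subset_span (Set.mul_mem_mul hA (hB2 i))
    · by_cases hi : i = 0
      · subst hi
        simp only [hk_tq, mul_add, mul_one, mul_smul_comm]
        exact Submodule.add_mem _
          (Submodule.smul_mem _ _ (Submodule.subset_span (Set.mul_mem_mul hA (hB2 0))))
          (Submodule.subset_span (Set.mul_mem_mul hA hB1))
      · exact Submodule.subset_span (Set.mul_mem_mul hA (hB3 i hi))
  | zero => simp
  | add x y _ _ hx hy => rw [mul_add, mul_add]; exact Submodule.add_mem _ hx hy
  | smul r x _ hx => rw [mul_smul_comm, mul_smul_comm]; exact Submodule.smul_mem _ _ hx
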